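/- arXiv:2112.03723 — 3 statements merged into one kernel-verified Lean document; each statement's English description precedes it below -/
import Mathlib

section
/- Fix integers B ≥ 1, C ≥ 1 and m ≥ 1. Let y_i ∈ ℝ^C (i = 1,…,B) be one-hot vectors and let a_{j,i} ∈ ℝ^C (j = 1,…,m, i = 1,…,B) be one-hot vectors such that a_{j,B} ≠ y_B for every j = 1,…,m. Let w ∈ ℝ^m satisfy w_j ≥ 0 for all j and Σ_{j=1}^m w_j = 1, and write f_w(i) = Σ_{j=1}^m w_j a_{j,i}. Then g_{new} := (2/(BC)) Σ_{i=1}^B ⟨f_w(i) − y_i, y_i⟩ satisfies g_{new} ≤ −2/(BC). -/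
open scoped BigOperators RealInnerProductSpace

/-- A vector is one-hot if exactly one coordinate equals 1 and all others equal 0. -/
def IsOneHot {C : ℕ} (v : EuclideanSpace ℝ (Fin C)) : Prop :=
  ∃ c : Fin C, v c = 1 ∧ ∀ c' : Fin C, c' ≠ c → v c' = 0

theorem IsOneHot.eq_single {C : ℕ} {v : EuclideanSpace ℝ (Fin C)} (hv : IsOneHot v) :
    ∃ c, v = EuclideanSpace.single c 1 := by
  obtain ⟨c, h1, h0⟩ := hv
  refine ⟨c, ?_⟩
  ext k
  by_cases hk : k = c
  · subst hk
    simp [h1]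
  · simp [h0 k hk, hk]

theorem IsOneHot.inner_self {C : ℕ} {v : EuclideanSpace ℝ (Fin C)} (hv : IsOneHot v) :
    ⟪v, v⟫ = 1 := by
  obtain ⟨c, rfl⟩ := hv.eq_single
  simp

theorem IsOneHot.inner_eq_zero {C : ℕ} {u v : EuclideanSpace ℝ (Fin C)} (hu : IsOneHot u)
    (hv : IsOneHot v) (h : u ≠ v) : ⟪u, v⟫ = 0 := by
  obtain ⟨c, rfl⟩ := hu.eq_single
  obtain ⟨d, rfl⟩ := hv.eq_single
  have hcd : c ≠ d := fun e => h (by rw [e])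
  simp [EuclideanSpace.inner_single_left, hcd]

theorem IsOneHot.inner_le_one {C : ℕ} {u v : EuclideanSpace ℝ (Fin C)} (hu : IsOneHot u)
    (hv : IsOneHot v) : ⟪u, v⟫ ≤ 1 := by
  by_cases h : u = v
  · rw [h, hv.inner_self]
  · rw [hu.inner_eq_zero hv h]
    exact zero_le_one

/-- If every tree of the ensemble misclassifies the new (last) observation, then the
partial derivative of the batch MSE loss with respect to the weight of a perfectly
fitting new tree, evaluated at weight 0, is at most `−2/(BC)`. -/
theorem shrub_new_tree_gradient_le
    (B C m : ℕ) (hB : 1 ≤ B) (hC : 1 ≤ C) (hm : 1 ≤ m)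
    (y : Fin B → EuclideanSpace ℝ (Fin C))
    (a : Fin m → Fin B → EuclideanSpace ℝ (Fin C))
    (hy : ∀ i, IsOneHot (y i))
    (ha : ∀ j i, IsOneHot (a j i))
    (iB : Fin B) (hiB : (iB : ℕ) = B - 1)
    (hmiss : ∀ j : Fin m, a j iB ≠ y iB)
    (w : Fin m → ℝ) (hw0 : ∀ j, 0 ≤ w j) (hw1 : ∑ j, w j = 1) :
    (2 / ((B : ℝ) * (C : ℝ))) * ∑ i, ⟪(∑ j, w j • a j i) - y i, y i⟫
      ≤ -(2 / ((B : ℝ) * (C : ℝ))) := by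
  have expand : ∀ i, ⟪(∑ j, w j • a j i) - y i, y i⟫ = ∑ j, w j * ⟪a j i, y i⟫ - 1 := by
    intro i
    rw [inner_sub_left, sum_inner, (hy i).inner_self]
    simp only [real_inner_smul_left]
  have nonpos : ∀ i, ⟪(∑ j, w j • a j i) - y i, y i⟫ ≤ 0 := by
    intro i
    rw [expand, sub_nonpos, ← hw1]
    exact Finset.sum_le_sum fun j _ =>
      mul_le_of_le_one_right (hw0 j) ((ha j i).inner_le_one (hy i))
  have last : ⟪(∑ j, w j • a j iB) - y iB, y iB⟫ = -1 := by
    rw [expand, Finset.sum_eq_zero, zero_sub]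
    intro j _
    rw [(ha j iB).inner_eq_zero (hy iB) (hmiss j), mul_zero]
  have total : ∑ i, ⟪(∑ j, w j • a j i) - y i, y i⟫ ≤ -1 := by
    rw [← Finset.add_sum_erase _ _ (Finset.mem_univ iB), last]
    linarith [Finset.sum_nonpos fun i (_ : i ∈ Finset.univ.erase iB) => nonpos i]
  calc (2 / ((B : ℝ) * (C : ℝ))) * ∑ i, ⟪(∑ j, w j • a j i) - y i, y i⟫
      ≤ (2 / ((B : ℝ) * (C : ℝ))) * (-1) := mul_le_mul_of_nonneg_left total (by positivity)
    _ = -(2 / ((B : ℝ) * (C : ℝ))) := mul_neg_one _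
end

section
/- (Theorem 1, case m < M.) Fix integers B ≥ 1, C ≥ 1 and m ≥ 1 and a real step size α > BC/(4m). Let y_i ∈ ℝ^C (i = 1,…,B) be one-hot vectors and let a_{j,i} ∈ ℝ^C (j = 1,…,m, i = 1,…,B) be one-hot vectors such that a_{j,i} = y_i for all j and all i ≤ B−1, while a_{j,B} ≠ y_B for every j. Let w ∈ ℝ^m satisfy w_j ≥ 0 for all j and Σ_{j=1}^m w_j = 1, and write f_w(i) = Σ_{k=1}^m w_k a_{k,i}. Define g_j := (2/(BC)) Σ_{i=1}^B ⟨f_w(i) − y_i, a_{j,i}⟩ for j = 1,…,m and g_{m+1} := (2/(BC)) Σ_{i=1}^B ⟨f_w(i) − y_i, y_i⟩, and define u ∈ ℝ^{m+1} by u_j = w_j − α·g_j for j ≤ m and u_{m+1} = −α·g_{m+1}. Then every vector v ∈ ℝ^{m+1} that minimizes ‖v − u‖ over the probability simplex {v ∈ ℝ^{m+1} : v_i ≥ 0 for all i, Σ_{i=1}^{m+1} v_i = 1} satisfies v_{m+1} > 0. In other words, the newly trained tree receives a strictly positive weight after the proximal gradient update and is added to the ensemble. -/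
open scoped BigOperators RealInnerProductSpace

namespace IsOneHot

variable {C : ℕ} {v w : EuclideanSpace ℝ (Fin C)}

theorem nonneg (hv : IsOneHot v) (c : Fin C) : 0 ≤ v c := by
  obtain ⟨d, hd, h⟩ := hv
  by_cases hc : c = d
  · simp [hc, hd]
  · simp [h c hc]

theorem inner_nonneg (hv : IsOneHot v) (hw : IsOneHot w) : 0 ≤ ⟪v, w⟫ := by
  rw [PiLp.inner_apply]
  exact Finset.sum_nonneg fun c _ => mul_nonneg (hw.nonneg c) (hv.nonneg c)

theorem inner_self_s7 (hv : IsOneHot v) : ⟪v, v⟫ = (1 : ℝ) := by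
  obtain ⟨d, hd, h⟩ := hv
  rw [PiLp.inner_apply, Finset.sum_eq_single d]
  · simp [hd]
  · intro c _ hc
    simp [h c hc]
  · simp

theorem inner_eq_zero_s7 (hv : IsOneHot v) (hw : IsOneHot w) (hne : v ≠ w) :
    ⟪v, w⟫ = (0 : ℝ) := by
  obtain ⟨d, hd, h⟩ := hv
  obtain ⟨e, he, h'⟩ := hw
  have hde : d ≠ e := by
    rintro rfl
    refine hne (PiLp.ext fun c => ?_)
    by_cases hc : c = d
    · rw [hc, hd, he]
    · rw [h c hc, h' c hc]
  rw [PiLp.inner_apply]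
  refine Finset.sum_eq_zero fun c _ => ?_
  by_cases hc : c = d
  · simp [hc, h' d hde]
  · simp [h c hc]

end IsOneHot

/-- First-order optimality for the projection onto the probability simplex: moving mass from a
coordinate in the support to any other coordinate cannot decrease the distance. -/
theorem sub_le_sub_of_isProjection_simplex {ι : Type*} [Fintype ι]
    {u v : EuclideanSpace ℝ ι} (hv0 : ∀ i, 0 ≤ v i) (hv1 : ∑ i, v i = 1)
    (hmin : ∀ v' : EuclideanSpace ℝ ι,
      ((∀ i, 0 ≤ v' i) ∧ ∑ i, v' i = 1) → ‖v - u‖ ≤ ‖v' - u‖)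
    {i k : ι} (hi : 0 < v i) : v i - u i ≤ v k - u k := by
  classical
  by_contra! hlt
  have hik : i ≠ k := by
    rintro rfl
    exact lt_irrefl _ hlt
  obtain ⟨t, ht0, ht⟩ := exists_between (lt_min hi (sub_pos.mpr hlt))
  obtain ⟨hti, htd⟩ := lt_min_iff.mp ht
  let e : EuclideanSpace ℝ ι := EuclideanSpace.single k 1 - EuclideanSpace.single i 1
  have hfeas : (∀ l, 0 ≤ (v + t • e) l) ∧ ∑ l, (v + t • e) l = 1 := by
    constructor
    · intro l
      have hl := hv0 l
      by_cases h : l = i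
      · subst h
        simp [e, hik]
        linarith
      · by_cases h' : l = k
        · subst h'
          simp [e, h]
          linarith
        · simpa [e, h, h'] using hl
    · simp [e, Finset.sum_add_distrib, ← Finset.mul_sum, hv1]
  have hle := hmin _ hfeas
  have hexp : ‖v + t • e - u‖ ^ 2 =
      ‖v - u‖ ^ 2 + 2 * (t * ((v k - u k) - (v i - u i))) + t ^ 2 * 2 := by
    have he : ‖e‖ ^ 2 = 2 := by
      rw [norm_sub_sq_real]
      simp [EuclideanSpace.inner_single_left, hik.symm]
      norm_num
    have hin : ⟪v - u, e⟫ = (v k - u k) - (v i - u i) := by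
      simp [e, inner_sub_right, EuclideanSpace.inner_single_right]
    rw [add_sub_right_comm, norm_add_sq_real, inner_smul_right, hin, norm_smul, mul_pow, he]
    simp
  have hsq : ‖v - u‖ ^ 2 ≤ ‖v + t • e - u‖ ^ 2 := by gcongr
  nlinarith

theorem exists_pos_and_le_of_sum_eq {ι : Type*} [Fintype ι] {v w : ι → ℝ}
    (hv0 : ∀ i, 0 ≤ v i) (hw0 : ∀ i, 0 ≤ w i) (hv : 0 < ∑ i, v i)
    (h : ∑ i, v i = ∑ i, w i) : ∃ i, 0 < v i ∧ w i ≤ v i := by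
  by_contra! hlt
  obtain ⟨i, hi, hpos⟩ := Finset.exists_lt_of_sum_lt (s := Finset.univ) (f := fun _ : ι => (0 : ℝ)) (g := v)
    (by simpa using hv)
  refine h.not_lt (Finset.sum_lt_sum (fun l _ => ?_) ⟨i, hi, hlt i hpos⟩)
  rcases (hv0 l).eq_or_lt with hl | hl
  · exact hl ▸ hw0 l
  · exact (hlt l hl).le

/-- Theorem 1 of the paper, case `m < M`: after the gradient step with step size
`α > BC/(4m)`, every Euclidean projection of the updated weight vector `u` onto the
probability simplex assigns a strictly positive weight to the newly trained tree. -/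
theorem shrub_new_tree_added
    (B C m : ℕ) (hB : 1 ≤ B) (hC : 1 ≤ C) (hm : 1 ≤ m)
    (α : ℝ) (hα : α > ((B : ℝ) * (C : ℝ)) / (4 * (m : ℝ)))
    (y : Fin B → EuclideanSpace ℝ (Fin C))
    (a : Fin m → Fin B → EuclideanSpace ℝ (Fin C))
    (hy : ∀ i, IsOneHot (y i))
    (ha : ∀ j i, IsOneHot (a j i))
    (iB : Fin B) (hiB : (iB : ℕ) = B - 1)
    (hfit : ∀ (j : Fin m) (i : Fin B), i ≠ iB → a j i = y i)
    (hmiss : ∀ j : Fin m, a j iB ≠ y iB)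
    (w : Fin m → ℝ) (hw0 : ∀ j, 0 ≤ w j) (hw1 : ∑ j, w j = 1)
    (g : Fin m → ℝ)
    (hg : ∀ j : Fin m,
      g j = (2 / ((B : ℝ) * (C : ℝ))) * ∑ i, ⟪(∑ k, w k • a k i) - y i, a j i⟫)
    (gnew : ℝ)
    (hgnew : gnew = (2 / ((B : ℝ) * (C : ℝ))) * ∑ i, ⟪(∑ k, w k • a k i) - y i, y i⟫)
    (u : EuclideanSpace ℝ (Fin (m + 1)))
    (hu : ∀ j : Fin m, u j.castSucc = w j - α * g j)
    (hunew : u (Fin.last m) = -(α * gnew)) :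
    ∀ v : EuclideanSpace ℝ (Fin (m + 1)),
      ((∀ i, 0 ≤ v i) ∧ ∑ i, v i = 1) →
      (∀ v' : EuclideanSpace ℝ (Fin (m + 1)),
        ((∀ i, 0 ≤ v' i) ∧ ∑ i, v' i = 1) → ‖v - u‖ ≤ ‖v' - u‖) →
      0 < v (Fin.last m) := by
  rintro v ⟨hv0, hv1⟩ hmin
  have hBC : (0 : ℝ) < B * C := by positivity
  have hα0 : 0 < α := lt_of_le_of_lt (by positivity) hα
  have hs : 0 < 2 / ((B : ℝ) * C) := by positivity
  have hres : ∀ i, i ≠ iB → (∑ k, w k • a k i) - y i = 0 := by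
    intro i hi
    simp [hfit _ i hi, ← Finset.sum_smul, hw1]
  have hsum : ∀ z : Fin B → EuclideanSpace ℝ (Fin C),
      ∑ i, ⟪(∑ k, w k • a k i) - y i, z i⟫ =
        ∑ k, w k * ⟪a k iB, z iB⟫ - ⟪y iB, z iB⟫ := by
    intro z
    rw [Finset.sum_eq_single iB (fun i _ hi => by rw [hres i hi, inner_zero_left]) (by simp),
      inner_sub_left, sum_inner]
    simp only [real_inner_smul_left]
  have hg0 : ∀ j, 0 ≤ g j := by
    intro j
    rw [hg, hsum, (hy iB).inner_eq_zero_s7 (ha j iB) (hmiss j).symm, sub_zero]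
    exact mul_nonneg hs.le (Finset.sum_nonneg fun k _ =>
      mul_nonneg (hw0 k) ((ha k iB).inner_nonneg (ha j iB)))
  have hgnew_neg : gnew < 0 := by
    rw [hgnew, hsum, (hy iB).inner_self_s7, Finset.sum_eq_zero fun k _ => by
      rw [(ha k iB).inner_eq_zero_s7 (hy iB) (hmiss k), mul_zero]]
    linarith
  by_contra hlast
  have hlast0 : v (Fin.last m) = 0 := le_antisymm (not_lt.mp hlast) (hv0 _)
  have hv1' : ∑ j : Fin m, v j.castSucc = 1 := by
    rwa [Fin.sum_univ_castSucc, hlast0, add_zero] at hv1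
  obtain ⟨j, hj, hwj⟩ := exists_pos_and_le_of_sum_eq (v := fun j : Fin m => v j.castSucc)
    (fun j => hv0 _) hw0 (by rw [hv1']; exact one_pos) (hv1'.trans hw1.symm)
  have hopt := sub_le_sub_of_isProjection_simplex hv0 hv1 hmin (k := Fin.last m) hj
  rw [hu, hunew, hlast0] at hopt
  have h1 := mul_nonneg hα0.le (hg0 j)
  have h2 := mul_neg_of_pos_of_neg hα0 hgnew_neg
  linarith
end

section
/- Let K ≥ 1 be an integer, let u ∈ ℝ^K, and let v be the Euclidean projection of u onto the probability simplex {v' ∈ ℝ^K : v'_i ≥ 0 for all i, Σ_{i=1}^K v'_i = 1} (i.e. v lies in the simplex and minimizes ‖v' − u‖ over it). Then the projection preserves the order of the coordinates: for all indices i, j, if u_i ≥ u_j then v_i ≥ v_j. -/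
open scoped BigOperators

/-- Euclidean projection onto the probability simplex preserves the order of the
coordinates: if `u_i ≥ u_j`, then the projected vector satisfies `v_i ≥ v_j`. -/
theorem simplex_projection_order_preserving
    (K : ℕ) (hK : 1 ≤ K)
    (u : EuclideanSpace ℝ (Fin K))
    (v : EuclideanSpace ℝ (Fin K))
    (hvmem : (∀ i, 0 ≤ v i) ∧ ∑ i, v i = 1)
    (hvmin : ∀ v' : EuclideanSpace ℝ (Fin K),
      ((∀ i, 0 ≤ v' i) ∧ ∑ i, v' i = 1) → ‖v - u‖ ≤ ‖v' - u‖) :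
    ∀ i j : Fin K, u j ≤ u i → v j ≤ v i := by
  intro i j hij
  by_contra! hlt
  have hne : i ≠ j := fun h => by simp [h] at hlt
  -- Replacing both coordinates by their mean gives a strictly closer point of the simplex.
  set t : ℝ := (v j - v i) / 2 with ht
  have htpos : 0 < t := by linarith
  set d : EuclideanSpace ℝ (Fin K) := EuclideanSpace.single i 1 - EuclideanSpace.single j 1 with hd
  have hmem : (∀ k, 0 ≤ (v + t • d) k) ∧ ∑ k, (v + t • d) k = 1 := by
    constructor
    · intro k
      have hi := hvmem.1 i
      have hk := hvmem.1 k
      rcases eq_or_ne k i with rfl | hki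
      · simp [hd, hne]
        linarith
      · rcases eq_or_ne k j with rfl | hkj
        · simp [hd, hki]
          linarith
        · simpa [hd, hki, hkj] using hk
    · simp [hd, Finset.sum_add_distrib, ← Finset.mul_sum, hvmem.2]
  have hinner : inner ℝ (v - u) d = (v i - u i) - (v j - u j) := by
    simp [hd, inner_sub_right, EuclideanSpace.inner_single_right]
  have hnorm : ‖d‖ ^ 2 = 2 := by
    rw [hd, norm_sub_sq_real]
    simp [EuclideanSpace.inner_single_right, hne]
    norm_num
  have hle := pow_le_pow_left₀ (norm_nonneg _) (hvmin _ hmem) 2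
  rw [add_sub_right_comm, norm_add_sq_real, inner_smul_right, hinner, norm_smul, mul_pow, hnorm,
    Real.norm_eq_abs, sq_abs] at hle
  nlinarith [mul_nonneg htpos.le (sub_nonneg.2 hij), mul_pos htpos htpos]
end
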